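/- Let ρ, σ ∈ D(ℋ) be states with supp(ρ) ⊆ supp(σ), and let λ, μ be real numbers. Then for every s ∈ [0,1] and every n ≥ 1: tr(ρ^{⊗n} − 2^{λn} σ^{⊗n})₊ ≤ 2^{−n(sμ − log₂ tr(ρ^{1+s}))} + 2^{−n(s(λ−μ) − s·dim(ℋ)·(log₂(1+n))/n − log₂ tr(ρ σ^{−s}))}, where σ^{−s} is defined via functional calculus on the support of σ (generalized inverse). -/

import Mathlib

open scoped BigOperators
open Filter ComplexOrder

noncomputable section

namespace GQSL

variable {I : Type*} [Fintype I] [DecidableEq I]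

/-- A quantum state: a positive semidefinite matrix of unit trace. -/
def IsState (ρ : Matrix I I ℂ) : Prop := ρ.PosSemidef ∧ ρ.trace = 1

/-- The `n`-fold tensor power of an operator, realized on `Fin n → I` indices. -/
def tpow (ρ : Matrix I I ℂ) (n : ℕ) : Matrix (Fin n → I) (Fin n → I) ℂ :=
  fun x y => ∏ i, ρ (x i) (y i)

/-- Functional calculus for Hermitian matrices (junk value `0` otherwise). -/
def fcal (f : ℝ → ℝ) (A : Matrix I I ℂ) : Matrix I I ℂ :=
  if hA : A.IsHermitian then
    (hA.eigenvectorUnitary : Matrix I I ℂ) *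
      Matrix.diagonal (fun i => (f (hA.eigenvalues i) : ℂ)) *
      star (hA.eigenvectorUnitary : Matrix I I ℂ)
  else 0

/-- Base-2 matrix logarithm, computed on the support. -/
def mlog (A : Matrix I I ℂ) : Matrix I I ℂ :=
  fcal (fun x => if 0 < x then Real.logb 2 x else 0) A

/-- Real matrix power, computed on the support (generalized inverse powers). -/
def mpow (A : Matrix I I ℂ) (t : ℝ) : Matrix I I ℂ :=
  fcal (fun x => if 0 < x then x ^ t else 0) A

/-- Matrix square root of a positive semidefinite matrix. -/
def msqrt (A : Matrix I I ℂ) : Matrix I I ℂ := fcal Real.sqrt A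

/-- Trace norm `‖A‖₁ = tr √(AᴴA)`. -/
def trNorm (A : Matrix I I ℂ) : ℝ := ((msqrt (A.conjTranspose * A)).trace).re

/-- Trace of the positive part of a Hermitian matrix: the sum of its positive eigenvalues. -/
def trPos (A : Matrix I I ℂ) : ℝ := ((fcal (fun x => max x 0) A).trace).re

/-- Fidelity `F(A,B) = tr √(√A B √A)`. -/
def fid (A B : Matrix I I ℂ) : ℝ := ((msqrt (msqrt A * B * msqrt A)).trace).re

/-- Von Neumann entropy (base 2). -/
def vnEnt (A : Matrix I I ℂ) : ℝ := -((A * mlog A).trace).re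

/-- `supp ρ ⊆ supp σ`, expressed via kernels. -/
def SuppLe (ρ σ : Matrix I I ℂ) : Prop := ∀ v, σ.mulVec v = 0 → ρ.mulVec v = 0

/-- Quantum relative entropy `S(ρ‖σ) = tr(ρ(log₂ρ − log₂σ))` (finite-value formula,
meaningful when `SuppLe ρ σ` holds). -/
def relEnt (ρ σ : Matrix I I ℂ) : ℝ := ((ρ * (mlog ρ - mlog σ)).trace).re

/-- `E_M(ρ) = inf {S(ρ‖σ) : σ ∈ M}`; states `σ` violating the support condition
have `S(ρ‖σ) = +∞` and hence do not contribute to the infimum. -/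
def EMset (M : Set (Matrix I I ℂ)) (ρ : Matrix I I ℂ) : ℝ :=
  sInf {x | ∃ σ ∈ M, SuppLe ρ σ ∧ x = relEnt ρ σ}

/-- Max-relative entropy `S_max(ρ‖σ) = inf {s : ρ ≤ 2^s σ}`. -/
def Smax (ρ σ : Matrix I I ℂ) : ℝ := sInf {s : ℝ | (((2:ℝ) ^ s) • σ - ρ).PosSemidef}

/-- Log robustness with respect to a set `M`. -/
def LR (M : Set (Matrix I I ℂ)) (ρ : Matrix I I ℂ) : ℝ :=
  sInf {x | ∃ σ ∈ M, x = Smax ρ σ}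

/-- Smoothed log robustness. -/
def LReps (M : Set (Matrix I I ℂ)) (ε : ℝ) (ρ : Matrix I I ℂ) : ℝ :=
  sInf {x | ∃ ρ', IsState ρ' ∧ trNorm (ρ' - ρ) ≤ ε ∧ x = LR M ρ'}

/-- Partial trace over the `k`-th tensor factor. -/
def ptraceAt {n : ℕ} (k : Fin (n + 1)) (ρ : Matrix (Fin (n + 1) → I) (Fin (n + 1) → I) ℂ) :
    Matrix (Fin n → I) (Fin n → I) ℂ :=
  fun x y => ∑ a : I, ρ (k.insertNth a x) (k.insertNth a y)

/-- Tensor product of operators on `n` and `m` copies. -/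
def tprod {n m : ℕ} (ρ : Matrix (Fin n → I) (Fin n → I) ℂ)
    (ν : Matrix (Fin m → I) (Fin m → I) ℂ) :
    Matrix (Fin (n + m) → I) (Fin (n + m) → I) ℂ :=
  fun x y => ρ (fun i => x (Fin.castAdd m i)) (fun i => y (Fin.castAdd m i)) *
    ν (fun j => x (Fin.natAdd n j)) (fun j => y (Fin.natAdd n j))

/-- Conjugation `P_π ρ P_π†` by the permutation unitary. -/
def permute {n : ℕ} (π : Equiv.Perm (Fin n)) (ρ : Matrix (Fin n → I) (Fin n → I) ℂ) :
    Matrix (Fin n → I) (Fin n → I) ℂ :=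
  fun x y => ρ (x ∘ π) (y ∘ π)

/-- A family of sets of states satisfying properties 1–5, with `σ` the fixed
full-rank state of property 2. -/
structure GoodFamily {d : ℕ} (σ : Matrix (Fin d) (Fin d) ℂ)
    (M : ∀ n : ℕ, Set (Matrix (Fin n → Fin d) (Fin n → Fin d) ℂ)) : Prop where
  states : ∀ n, ∀ ρ ∈ M n, IsState ρ
  convex : ∀ n, Convex ℝ (M n)
  closed : ∀ n, IsClosed (M n)
  sigma_state : IsState σ
  sigma_posdef : σ.PosDef
  sigma_mem : ∀ n, tpow σ n ∈ M n
  ptrace_mem : ∀ n (k : Fin (n + 1)), ∀ ρ ∈ M (n + 1), ptraceAt k ρ ∈ M n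
  tprod_mem : ∀ n m, ∀ ρ ∈ M n, ∀ ν ∈ M m, tprod ρ ν ∈ M (n + m)
  perm_mem : ∀ n (π : Equiv.Perm (Fin n)), ∀ ρ ∈ M n, permute π ρ ∈ M n

/-- The rank-one operator `|f⟩⟨f|`. -/
def vecOp {J : Type*} (f : J → ℂ) : Matrix J J ℂ := fun x y => f x * star (f y)

/-- Squared ℓ²-norm of a vector. -/
def vecNormSq {J : Type*} [Fintype J] (f : J → ℂ) : ℝ := ∑ x, Complex.normSq (f x)

/-- ℓ²-norm of a vector. -/
def l2norm {J : Type*} [Fintype J] (f : J → ℂ) : ℝ := Real.sqrt (vecNormSq f)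

/-- Membership in the symmetric subspace. -/
def IsSymVec {J : Type*} {N : ℕ} (f : (Fin N → J) → ℂ) : Prop :=
  ∀ (π : Equiv.Perm (Fin N)) (x : Fin N → J), f (x ∘ π) = f x

/-- Unnormalized symmetrization `Σ_π P_π ψ`. -/
def symmetrize {J : Type*} {N : ℕ} (ψ : (Fin N → J) → ℂ) : (Fin N → J) → ℂ :=
  fun x => ∑ π : Equiv.Perm (Fin N), ψ (x ∘ π)

/-- Normalized symmetrization `Sym(ψ)`. -/
def SymOf {J : Type*} [Fintype J] {N : ℕ} (ψ : (Fin N → J) → ℂ) : (Fin N → J) → ℂ :=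
  ((l2norm (symmetrize ψ) : ℂ))⁻¹ • symmetrize ψ

/-- Partial trace over the first `m` of `m + k` tensor factors. -/
def ptraceFirst {J : Type*} [Fintype J] [DecidableEq J] {m k : ℕ}
    (ρ : Matrix (Fin (m + k) → J) (Fin (m + k) → J) ℂ) :
    Matrix (Fin k → J) (Fin k → J) ℂ :=
  fun x y => ∑ a : Fin m → J, ρ (Fin.append a x) (Fin.append a y)

/-- Partial trace over the environment components of `N` system–environment pairs. -/
def ptraceE {A E : Type*} [Fintype A] [Fintype E] {N : ℕ}
    (ρ : Matrix (Fin N → A × E) (Fin N → A × E) ℂ) :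
    Matrix (Fin N → A) (Fin N → A) ℂ :=
  fun x y => ∑ e : Fin N → E, ρ (fun i => (x i, e i)) (fun i => (y i, e i))

/-- The set of `(N choose r)`-i.i.d. vectors along `θ`: vectors which are `θ` on
`N − r` of the positions (the permutations of `θ^{⊗(N−r)} ⊗ ψ_r`). -/
def powVecSet {J : Type*} (θ : J → ℂ) (N r : ℕ) : Set ((Fin N → J) → ℂ) :=
  {f | ∃ S : Finset (Fin N), S.card = N - r ∧
    ∃ ψ : ({i : Fin N // i ∉ S} → J) → ℂ,
      f = fun x => (∏ i ∈ S, θ (x i)) * ψ (fun j => x j.1)}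

/-- Almost power states along `θ`: `|θ⟩^{[⊗,N,r]} = Sym(ℋ^{⊗N}) ∩ span V(ℋ^{⊗N}, θ^{⊗N−r})`. -/
def almostPower {J : Type*} (θ : J → ℂ) (N r : ℕ) : Set ((Fin N → J) → ℂ) :=
  {f | IsSymVec f ∧ f ∈ Submodule.span ℂ (powVecSet θ N r)}

/-- `η ⊗ θ^{⊗(N−k)}`: the vector `η` on the first `k` slots and `θ` on the rest. -/
def etaTensor {J : Type*} {N k : ℕ} (h : k ≤ N) (η : (Fin k → J) → ℂ) (θ : J → ℂ) :
    (Fin N → J) → ℂ :=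
  fun x => η (fun i => x (Fin.castLE h i)) * ∏ i : Fin N, if (i : ℕ) < k then 1 else θ (x i)

/-- `η` lies in the `k`-fold tensor power of the orthogonal complement of `θ`:
the contraction of `η` with `⟨θ|` at any slot vanishes. -/
def InPerpPow {J : Type*} [Fintype J] [DecidableEq J] {k : ℕ} (θ : J → ℂ)
    (η : (Fin k → J) → ℂ) : Prop :=
  ∀ (j : Fin k) (z : Fin k → J), ∑ a : J, star (θ a) * η (Function.update z j a) = 0

/-- Binary Shannon entropy. -/
def binEnt (x : ℝ) : ℝ := -(x * Real.logb 2 x) - (1 - x) * Real.logb 2 (1 - x)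

/-- Product operator `σ₁ ⊗ ⋯ ⊗ σ_k` of a `k`-partite system. -/
def prodOp {k : ℕ} {ι : Fin k → Type*} [∀ i, Fintype (ι i)]
    (σs : ∀ i, Matrix (ι i) (ι i) ℂ) : Matrix (∀ i, ι i) (∀ i, ι i) ℂ :=
  fun x y => ∏ i, σs i (x i) (y i)

/-- Separability of a `k`-partite state: a finite convex combination of product states. -/
def IsSeparable {k : ℕ} {ι : Fin k → Type*} [∀ i, Fintype (ι i)]
    (ρ : Matrix (∀ i, ι i) (∀ i, ι i) ℂ) : Prop :=
  ∃ (m : ℕ) (p : Fin m → ℝ) (σs : Fin m → ∀ i, Matrix (ι i) (ι i) ℂ),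
    (∀ j, 0 ≤ p j) ∧ (∑ j, p j = 1) ∧ (∀ j i, IsState (σs j i)) ∧
    ρ = ∑ j, p j • prodOp (σs j)

/-- Relative entropy of entanglement `E_R(ρ) = inf {S(ρ‖ω) : ω separable}`. -/
def ERel {k : ℕ} {ι : Fin k → Type*} [∀ i, Fintype (ι i)] [∀ i, DecidableEq (ι i)]
    (ρ : Matrix (∀ i, ι i) (∀ i, ι i) ℂ) : ℝ :=
  sInf {x | ∃ ω, IsSeparable ω ∧ SuppLe ρ ω ∧ x = relEnt ρ ω}

/-- `ρ^{⊗n}` of a `k`-partite state, viewed as a `k`-partite state where the `i`-th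
party holds the `n` copies of its system. -/
def tpowMulti {k : ℕ} {d : Fin k → ℕ} (ρ : Matrix (∀ i, Fin (d i)) (∀ i, Fin (d i)) ℂ)
    (n : ℕ) : Matrix (∀ i, Fin n → Fin (d i)) (∀ i, Fin n → Fin (d i)) ℂ :=
  fun x y => ∏ t : Fin n, ρ (fun i => x i t) (fun i => y i t)

/-- `ρ^{⊗n}` of a bipartite state in the grouped bipartition `A^{⊗n} : B^{⊗n}`. -/
def tpowBi {A B : Type*} [Fintype A] [Fintype B]
    (ρ : Matrix (A × B) (A × B) ℂ) (n : ℕ) :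
    Matrix ((Fin n → A) × (Fin n → B)) ((Fin n → A) × (Fin n → B)) ℂ :=
  fun x y => ∏ i, ρ (x.1 i, x.2 i) (y.1 i, y.2 i)

/-- `k`-extendibility of a bipartite state. -/
def IsKExtendible {A B : Type*} [Fintype A] [Fintype B] (k : ℕ)
    (σ : Matrix (A × B) (A × B) ℂ) : Prop :=
  ∃ σ' : Matrix (A × (Fin k → B)) (A × (Fin k → B)) ℂ,
    IsState σ' ∧
    (∀ (π : Equiv.Perm (Fin k)) (p q : A × (Fin k → B)),
      σ' (p.1, p.2 ∘ π) (q.1, q.2 ∘ π) = σ' p q) ∧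
    (∀ p q : A × B, σ p q =
      ∑ f : {i : Fin k // (i : ℕ) ≠ 0} → B,
        σ' (p.1, fun i => if h : (i : ℕ) = 0 then p.2 else f ⟨i, h⟩)
           (q.1, fun i => if h : (i : ℕ) = 0 then q.2 else f ⟨i, h⟩))

/-- The matrix with real eigenvalues `f` in the orthonormal basis given by the columns of `U`. -/
def spec (U : Matrix.unitaryGroup I ℂ) (f : I → ℝ) : Matrix I I ℂ :=
  (U : Matrix I I ℂ) * Matrix.diagonal (fun i => (f i : ℂ)) * star (U : Matrix I I ℂ)

lemma spec_add (U : Matrix.unitaryGroup I ℂ) (f g : I → ℝ) :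
    spec U (f + g) = spec U f + spec U g := by
  simp only [spec, ← add_mul, ← mul_add, Matrix.diagonal_add, Pi.add_apply, Complex.ofReal_add]

lemma spec_smul (U : Matrix.unitaryGroup I ℂ) (c : ℝ) (f : I → ℝ) :
    spec U (c • f) = c • spec U f := by
  have h : Matrix.diagonal (fun i => ((c • f) i : ℂ)) =
      c • Matrix.diagonal (fun i => (f i : ℂ)) := by
    ext i j
    by_cases hij : i = j <;> simp [Matrix.diagonal, hij]
  rw [spec, h, spec, Matrix.mul_smul, Matrix.smul_mul]

lemma spec_one (U : Matrix.unitaryGroup I ℂ) : spec U 1 = 1 := by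
  simp [spec]

lemma spec_mul (U : Matrix.unitaryGroup I ℂ) (f g : I → ℝ) :
    spec U (f * g) = spec U f * spec U g := by
  have h : star (U : Matrix I I ℂ) * (U : Matrix I I ℂ) = 1 := by simp
  calc spec U (f * g)
      = (U : Matrix I I ℂ) * (Matrix.diagonal (fun i => (f i : ℂ)) *
          Matrix.diagonal (fun i => (g i : ℂ))) * star (U : Matrix I I ℂ) := by
        simp [spec, Matrix.diagonal_mul_diagonal]
    _ = (U : Matrix I I ℂ) * Matrix.diagonal (fun i => (f i : ℂ)) *
          (star (U : Matrix I I ℂ) * (U : Matrix I I ℂ)) *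
          Matrix.diagonal (fun i => (g i : ℂ)) * star (U : Matrix I I ℂ) := by
        rw [h]; simp only [mul_assoc, one_mul]
    _ = spec U f * spec U g := by simp only [spec, mul_assoc]

lemma spec_posSemidef (U : Matrix.unitaryGroup I ℂ) {f : I → ℝ} (hf : ∀ i, 0 ≤ f i) :
    (spec U f).PosSemidef := by
  refine (Matrix.PosSemidef.diagonal (d := fun i => (f i : ℂ)) ?_).mul_mul_conjTranspose_same _
  intro i
  exact Complex.zero_le_real.2 (hf i)

lemma trace_mul_spec (A : Matrix I I ℂ) (U : Matrix.unitaryGroup I ℂ) (f : I → ℝ) :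
    (A * spec U f).trace =
      ∑ i, (star (U : Matrix I I ℂ) * A * (U : Matrix I I ℂ)) i i * (f i : ℂ) := by
  have h : (A * spec U f).trace = ((star (U : Matrix I I ℂ) * A * (U : Matrix I I ℂ)) *
      Matrix.diagonal (fun i => (f i : ℂ))).trace := by
    rw [spec, ← mul_assoc, ← mul_assoc, Matrix.trace_mul_comm]
    simp only [mul_assoc]
  rw [h, Matrix.trace]
  simp only [Matrix.diag, Matrix.mul_diagonal]

lemma re_trace_mul_spec (A : Matrix I I ℂ) (U : Matrix.unitaryGroup I ℂ) (f : I → ℝ) :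
    (A * spec U f).trace.re =
      ∑ i, ((star (U : Matrix I I ℂ) * A * (U : Matrix I I ℂ)) i i).re * f i := by
  simp [trace_mul_spec]

lemma trace_spec (U : Matrix.unitaryGroup I ℂ) (f : I → ℝ) :
    (spec U f).trace.re = ∑ i, f i := by
  simpa using re_trace_mul_spec 1 U f

lemma eq_spec {A : Matrix I I ℂ} (hA : A.IsHermitian) :
    A = spec hA.eigenvectorUnitary hA.eigenvalues := by
  conv_lhs => rw [hA.spectral_theorem]
  rfl

lemma fcal_eq_spec {A : Matrix I I ℂ} (hA : A.IsHermitian) (f : ℝ → ℝ) :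
    fcal f A = spec hA.eigenvectorUnitary (fun i => f (hA.eigenvalues i)) := by
  rw [fcal, dif_pos hA, spec]

lemma trace_mul_nonneg {A B : Matrix I I ℂ} (hA : A.PosSemidef) (hB : B.PosSemidef) :
    0 ≤ (A * B).trace := by
  rw [eq_spec hB.1, trace_mul_spec]
  exact Finset.sum_nonneg fun i _ => mul_nonneg
    (hA.conjTranspose_mul_mul_same _).diag_nonneg
    (Complex.zero_le_real.2 (hB.eigenvalues_nonneg i))

lemma re_trace_mul_nonneg {A B : Matrix I I ℂ} (hA : A.PosSemidef) (hB : B.PosSemidef) :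
    0 ≤ (A * B).trace.re :=
  (Complex.le_def.1 (trace_mul_nonneg hA hB)).1

/-- Variational form of the trace of the positive part. -/
lemma exists_projection_trPos {X : Matrix I I ℂ} (hX : X.IsHermitian) :
    ∃ P : Matrix I I ℂ, P.PosSemidef ∧ (1 - P).PosSemidef ∧ P * P = P ∧
      trPos X = (P * X).trace.re := by
  set f : I → ℝ := fun i => if 0 < hX.eigenvalues i then 1 else 0 with hf
  refine ⟨spec hX.eigenvectorUnitary f, spec_posSemidef _ fun i => ?_, ?_, ?_, ?_⟩
  · simp only [hf]; split_ifs <;> norm_num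
  · have h : (1 : Matrix I I ℂ) - spec hX.eigenvectorUnitary f =
        spec hX.eigenvectorUnitary (1 - f) := by
      rw [sub_eq_iff_eq_add, ← spec_add, sub_add_cancel, spec_one]
    rw [h]
    refine spec_posSemidef _ fun i => ?_
    simp only [hf, Pi.sub_apply, Pi.one_apply]; split_ifs <;> norm_num
  · rw [← spec_mul]
    congr 1
    ext i
    simp [hf]
  · have h : spec hX.eigenvectorUnitary f * X =
        spec hX.eigenvectorUnitary (f * hX.eigenvalues) := by
      rw [spec_mul, ← eq_spec hX]
    rw [h, trPos, fcal_eq_spec hX]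
    congr 3
    ext i
    simp only [hf, Pi.mul_apply]
    split_ifs with h
    · rw [max_eq_left h.le, one_mul]
    · rw [max_eq_right (not_lt.1 h), zero_mul]

/-- If `0 ≤ T ≤ 1`, `B ≥ 0`, `P` is an orthogonal projection and `C = (B + 1)⁻¹`, then
`tr P(T - B) ≤ tr T(B + 1)⁻¹`. -/
lemma re_trace_projection_sub_le {P T B C : Matrix I I ℂ} (hP : P.PosSemidef) (hPP : P * P = P)
    (hT : T.PosSemidef) (hT1 : (1 - T).PosSemidef) (hB : B.PosSemidef) (hC : C.PosSemidef)
    (hCB : C * (B + 1) = 1) (hBC : (B + 1) * C = 1) :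
    (P * T).trace.re - (P * B).trace.re ≤ (T * C).trace.re := by
  have hPH : P.conjTranspose = P := hP.1
  have hconj : (1 - (B + 1) * P).conjTranspose = 1 - P * (B + 1) := by
    simp [Matrix.conjTranspose_mul, hPH, hB.1.eq]
  have hexp : (1 - P * (B + 1)) * C * (1 - (B + 1) * P) = C - P + P * B * P := by
    calc (1 - P * (B + 1)) * C * (1 - (B + 1) * P)
        = C - C * (B + 1) * P - P * ((B + 1) * C) + P * ((B + 1) * C) * (B + 1) * P := by
          noncomm_ring
      _ = C - P + P * B * P - P + P * P := by rw [hCB, hBC]; noncomm_ring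
      _ = C - P + P * B * P := by rw [hPP]; abel
  have hpsd : (C - P + P * B * P).PosSemidef := by
    rw [← hexp, ← hconj]
    exact hC.conjTranspose_mul_mul_same _
  have hfst := re_trace_mul_nonneg hT hpsd
  have hcompress : (P - P * T * P).PosSemidef := by
    have h := hT1.conjTranspose_mul_mul_same P
    rwa [hPH, mul_sub, sub_mul, mul_one, hPP] at h
  have hsnd := re_trace_mul_nonneg hcompress hB
  have hcyc : (T * (P * B * P)).trace = (P * T * P * B).trace := by
    rw [← mul_assoc, Matrix.trace_mul_comm]
    simp only [mul_assoc]
  rw [mul_add, mul_sub, Matrix.trace_add, Matrix.trace_sub, hcyc, Matrix.trace_mul_comm T P] at hfst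
  rw [sub_mul, Matrix.trace_sub] at hsnd
  simp only [Complex.add_re, Complex.sub_re] at hfst hsnd
  linarith

lemma inv_add_one_le_rpow_neg {b s : ℝ} (hb : 0 < b) (hs0 : 0 ≤ s) (hs1 : s ≤ 1) :
    (b + 1)⁻¹ ≤ b ^ (-s) := by
  rw [Real.rpow_neg hb.le]
  refine inv_anti₀ (Real.rpow_pos_of_pos hb s) ?_
  rcases le_total b 1 with h | h
  · linarith [Real.rpow_le_one hb.le h hs0]
  · have := Real.rpow_le_rpow_of_exponent_le h hs1
    rw [Real.rpow_one] at this
    linarith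

lemma max_sub_zero_le_rpow {r M s : ℝ} (hr : 0 ≤ r) (hM : 0 < M) (hs0 : 0 ≤ s) :
    max (r - M) 0 ≤ M ^ (-s) * (if 0 < r then r ^ (1 + s) else 0) := by
  rcases le_or_gt r M with h | h
  · rw [max_eq_right (by linarith)]
    split_ifs <;> positivity
  · have hr0 : 0 < r := hM.trans h
    rw [max_eq_left (by linarith), if_pos hr0, Real.rpow_add hr0, Real.rpow_one,
      Real.rpow_neg hM.le]
    have h1 : M ^ s ≤ r ^ s := Real.rpow_le_rpow hM.le h.le hs0
    have hMs : 0 < M ^ s := Real.rpow_pos_of_pos hM s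
    have h2 : 1 ≤ (M ^ s)⁻¹ * r ^ s := by
      rw [inv_mul_eq_div, one_le_div hMs]; exact h1
    nlinarith

/-- One-shot bound with truncation level `M`. -/
lemma trPos_spec_sub_smul_spec_le (U V : Matrix.unitaryGroup I ℂ) {r t : I → ℝ}
    (hr : ∀ i, 0 ≤ r i) (ht : ∀ i, 0 ≤ t i)
    (hker : ∀ i, t i = 0 →
      (star (V : Matrix I I ℂ) * spec U r * (V : Matrix I I ℂ)) i i = 0)
    {M a s : ℝ} (hM : 0 < M) (ha : 0 < a) (hs0 : 0 ≤ s) (hs1 : s ≤ 1) :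
    trPos (spec U r - a • spec V t) ≤
      M ^ (-s) * (spec U (fun i => if 0 < r i then r i ^ (1 + s) else 0)).trace.re +
      (a / M) ^ (-s) *
        (spec U r * spec V (fun i => if 0 < t i then t i ^ (-s) else 0)).trace.re := by
  have hR := spec_posSemidef U hr
  have hX : (spec U r - a • spec V t).IsHermitian := by
    rw [← spec_smul]
    exact hR.1.sub (spec_posSemidef V fun i => mul_nonneg ha.le (ht i)).1
  obtain ⟨P, hP, hP1, hPP, htr⟩ := exists_projection_trPos hX
  set tail : I → ℝ := fun i => max (r i - M) 0 with htail
  set low : I → ℝ := fun i => min (r i) M / M with hlow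
  set b : I → ℝ := fun i => a / M * t i with hb
  have hb0 : ∀ i, 0 ≤ b i := fun i => mul_nonneg (div_pos ha hM).le (ht i)
  have hlow0 : ∀ i, 0 ≤ low i := fun i => div_nonneg (le_min (hr i) hM.le) hM.le
  have hlow1 : ∀ i, low i ≤ 1 := fun i => (div_le_one hM).2 (min_le_right _ _)
  have hrsplit : r = tail + M • low := by
    ext i
    simp only [htail, hlow, Pi.add_apply, Pi.smul_apply, smul_eq_mul]
    rw [mul_div_cancel₀ _ hM.ne']
    rcases le_total (r i) M with h | h
    · rw [max_eq_right (by linarith), min_eq_left h, zero_add]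
    · rw [max_eq_left (by linarith), min_eq_right h, sub_add_cancel]
  have hsplit : spec U r - a • spec V t = spec U tail + M • (spec U low - spec V b) := by
    have hbt : M • b = a • t := by
      ext i
      simp only [hb, Pi.smul_apply, smul_eq_mul]
      field_simp
    rw [smul_sub, ← spec_smul, ← spec_smul, ← spec_smul, hbt, ← add_sub_assoc, ← spec_add,
      ← hrsplit]
  have htail_le : (P * spec U tail).trace.re ≤
      M ^ (-s) * (spec U (fun i => if 0 < r i then r i ^ (1 + s) else 0)).trace.re := by
    have h := re_trace_mul_nonneg hP1
      (spec_posSemidef U (f := tail) fun i => le_max_right _ _)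
    rw [sub_mul, one_mul, Matrix.trace_sub, Complex.sub_re, trace_spec] at h
    rw [trace_spec, Finset.mul_sum]
    exact (sub_nonneg.1 h).trans
      (Finset.sum_le_sum fun i _ => max_sub_zero_le_rpow (hr i) hM hs0)
  have hinv : ∀ i, (b i + 1) ≠ 0 := fun i => by linarith [hb0 i]
  have hcore := re_trace_projection_sub_le (P := P) (T := spec U low) (B := spec V b)
    (C := spec V (fun i => (b i + 1)⁻¹)) hP hPP (spec_posSemidef U hlow0)
    (by
      have h : (1 : Matrix I I ℂ) - spec U low = spec U (1 - low) := by
        rw [sub_eq_iff_eq_add, ← spec_add, sub_add_cancel, spec_one]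
      rw [h]
      exact spec_posSemidef U fun i => sub_nonneg.2 (hlow1 i))
    (spec_posSemidef V hb0) (spec_posSemidef V fun i => inv_nonneg.2 (by linarith [hb0 i]))
    (by
      rw [← spec_one V, ← spec_add, ← spec_mul]
      congr 1
      ext i
      simp [hinv i])
    (by
      rw [← spec_one V, ← spec_add, ← spec_mul]
      congr 1
      ext i
      simp [hinv i])
  have hlow_le : M * (spec U low * spec V (fun i => (b i + 1)⁻¹)).trace.re ≤
      (spec U r * spec V (fun i => (b i + 1)⁻¹)).trace.re := by
    have h := re_trace_mul_nonneg (spec_posSemidef U (f := tail) fun i => le_max_right _ _)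
      (spec_posSemidef V (f := fun i => (b i + 1)⁻¹)
        fun i => inv_nonneg.2 (by linarith [hb0 i]))
    rw [hrsplit, spec_add, spec_smul, add_mul, Matrix.smul_mul, Matrix.trace_add,
      Matrix.trace_smul, Complex.add_re, Complex.smul_re, smul_eq_mul]
    linarith
  have hweight : (spec U r * spec V (fun i => (b i + 1)⁻¹)).trace.re ≤
      (a / M) ^ (-s) *
        (spec U r * spec V (fun i => if 0 < t i then t i ^ (-s) else 0)).trace.re := by
    rw [re_trace_mul_spec, re_trace_mul_spec, Finset.mul_sum]
    refine Finset.sum_le_sum fun i _ => ?_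
    have hdiag : 0 ≤ ((star (V : Matrix I I ℂ) * spec U r * (V : Matrix I I ℂ)) i i).re :=
      (Complex.le_def.1 ((hR.conjTranspose_mul_mul_same _).diag_nonneg)).1
    rcases (ht i).eq_or_lt with h | h
    · simp [hker i h.symm]
    · rw [if_pos h, mul_left_comm, ← Real.mul_rpow (div_pos ha hM).le (ht i)]
      exact mul_le_mul_of_nonneg_left
        (inv_add_one_le_rpow_neg (mul_pos (div_pos ha hM) h) hs0 hs1) hdiag
  rw [htr, hsplit, mul_add, Matrix.mul_smul, Matrix.trace_add, Matrix.trace_smul, Complex.add_re,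
    Complex.smul_re, mul_sub, Matrix.trace_sub, Complex.sub_re, smul_eq_mul]
  linarith [mul_le_mul_of_nonneg_left hcore hM.le]

lemma tpow_mul (A B : Matrix I I ℂ) (n : ℕ) : tpow (A * B) n = tpow A n * tpow B n := by
  ext x y
  simp only [tpow, Matrix.mul_apply, Finset.prod_univ_sum, Fintype.piFinset_univ,
    Finset.prod_mul_distrib]

lemma tpow_diagonal (f : I → ℂ) (n : ℕ) :
    tpow (Matrix.diagonal f) n = Matrix.diagonal (fun x => ∏ i, f (x i)) := by
  ext x y
  by_cases h : x = y
  · subst h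
    simp [tpow]
  · obtain ⟨i, hi⟩ := Function.ne_iff.1 h
    rw [Matrix.diagonal_apply_ne _ h]
    exact Finset.prod_eq_zero (Finset.mem_univ i) (Matrix.diagonal_apply_ne _ hi)

lemma tpow_one (n : ℕ) : tpow (1 : Matrix I I ℂ) n = 1 := by
  rw [← Matrix.diagonal_one, tpow_diagonal]
  simp

lemma tpow_star (A : Matrix I I ℂ) (n : ℕ) : tpow (star A) n = star (tpow A n) := by
  ext x y
  simp [tpow, Matrix.star_apply]

lemma trace_tpow (A : Matrix I I ℂ) (n : ℕ) : (tpow A n).trace = A.trace ^ n := by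
  simp only [Matrix.trace, Matrix.diag, tpow, Finset.sum_pow', Fintype.piFinset_univ]

/-- The tensor power of a unitary. -/
def unitaryTpow (U : Matrix.unitaryGroup I ℂ) (n : ℕ) : Matrix.unitaryGroup (Fin n → I) ℂ :=
  ⟨tpow (U : Matrix I I ℂ) n, by
    rw [Matrix.mem_unitaryGroup_iff, ← tpow_star, ← tpow_mul,
      Matrix.mem_unitaryGroup_iff.1 U.2, tpow_one]⟩

lemma tpow_spec (U : Matrix.unitaryGroup I ℂ) (f : I → ℝ) (n : ℕ) :
    tpow (spec U f) n = spec (unitaryTpow U n) (fun x => ∏ i, f (x i)) := by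
  rw [spec, tpow_mul, tpow_mul, tpow_diagonal, tpow_star, spec]
  simp [unitaryTpow]

lemma prod_ite_rpow {n : ℕ} {f : I → ℝ} (hf : ∀ i, 0 ≤ f i) (p : ℝ) (x : Fin n → I) :
    (∏ i, if 0 < f (x i) then f (x i) ^ p else 0) =
      if 0 < ∏ i, f (x i) then (∏ i, f (x i)) ^ p else 0 := by
  by_cases h : ∀ i, 0 < f (x i)
  · rw [if_pos (Finset.prod_pos fun i _ => h i), ← Real.finsetProd_rpow _ _ fun i _ => hf _]
    exact Finset.prod_congr rfl fun i _ => if_pos (h i)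
  · push Not at h
    obtain ⟨i, hi⟩ := h
    have hzero : ∏ i, f (x i) = 0 :=
      Finset.prod_eq_zero (Finset.mem_univ i) (le_antisymm hi (hf _))
    rw [hzero, if_neg (lt_irrefl _)]
    exact Finset.prod_eq_zero (Finset.mem_univ i) (if_neg hi.not_gt)

lemma tpow_mpow {A : Matrix I I ℂ} (hA : A.PosSemidef) (p : ℝ) (n : ℕ) :
    tpow (mpow A p) n = spec (unitaryTpow hA.1.eigenvectorUnitary n) (fun x =>
      if 0 < ∏ i, hA.1.eigenvalues (x i) then (∏ i, hA.1.eigenvalues (x i)) ^ p else 0) := by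
  rw [mpow, fcal_eq_spec hA.1, tpow_spec]
  congr 1
  ext x
  exact prod_ite_rpow hA.eigenvalues_nonneg p x

lemma eigen_diag_eq_zero {ρ σ : Matrix I I ℂ} (hσ : σ.IsHermitian) (hsupp : SuppLe ρ σ) {i : I}
    (hi : hσ.eigenvalues i = 0) :
    (star (hσ.eigenvectorUnitary : Matrix I I ℂ) * ρ *
      (hσ.eigenvectorUnitary : Matrix I I ℂ)) i i = 0 := by
  have h := hsupp (⇑(hσ.eigenvectorBasis i)) (by rw [hσ.mulVec_eigenvectorBasis, hi, zero_smul])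
  rw [mul_assoc, Matrix.mul_apply]
  refine Finset.sum_eq_zero fun j _ => ?_
  have hj : (ρ * (hσ.eigenvectorUnitary : Matrix I I ℂ)) j i = 0 := by
    simpa [Matrix.mul_apply, Matrix.mulVec, dotProduct,
      Matrix.IsHermitian.eigenvectorUnitary_apply] using congrFun h j
  rw [hj, mul_zero]

lemma re_pow_of_nonneg {z : ℂ} (hz : 0 ≤ z) (n : ℕ) : (z ^ n).re = z.re ^ n := by
  have h : z = (z.re : ℂ) := Complex.ext rfl (by simpa using (Complex.le_def.1 hz).2.symm)
  conv_lhs => rw [h]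
  norm_cast

lemma mpow_posSemidef {A : Matrix I I ℂ} (hA : A.PosSemidef) (p : ℝ) :
    (mpow A p).PosSemidef := by
  rw [mpow, fcal_eq_spec hA.1]
  refine spec_posSemidef _ fun i => ?_
  have := hA.eigenvalues_nonneg i
  split_ifs <;> positivity

lemma two_rpow_mul_pow_le {e x : ℝ} (hx : 0 ≤ x) {n : ℕ} (hn : 1 ≤ n) :
    (2 : ℝ) ^ e * x ^ n ≤ (2 : ℝ) ^ (e + n * Real.logb 2 x) := by
  rcases hx.eq_or_lt with rfl | hx
  · rw [zero_pow (by omega), mul_zero]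
    positivity
  · rw [Real.rpow_add two_pos, mul_comm (n : ℝ), Real.rpow_mul two_pos.le,
      Real.rpow_logb two_pos (by norm_num) hx, Real.rpow_natCast]

/-- **Lemma (Ogawa–Nagaoka type bound).**  For states `ρ, σ` with
`supp ρ ⊆ supp σ`, reals `λ, μ`, every `s ∈ [0,1]` and `n ≥ 1`:
`tr(ρ^{⊗n} − 2^{λn} σ^{⊗n})₊ ≤ 2^{−n(sμ − log₂ tr ρ^{1+s})}
  + 2^{−n(s(λ−μ) − s d log₂(1+n)/n − log₂ tr(ρ σ^{−s}))`. -/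
theorem ogawa_nagaoka_adaptation {d : ℕ} (ρ σ : Matrix (Fin d) (Fin d) ℂ)
    (hρ : IsState ρ) (hσ : IsState σ) (hsupp : SuppLe ρ σ)
    (lam μ : ℝ) (s : ℝ) (hs0 : 0 ≤ s) (hs1 : s ≤ 1) (n : ℕ) (hn : 1 ≤ n) :
    trPos (tpow ρ n - ((2:ℝ) ^ (lam * (n:ℝ))) • tpow σ n) ≤
      (2:ℝ) ^ (-((n:ℝ) * (s * μ - Real.logb 2 (((mpow ρ (1 + s)).trace).re)))) +
      (2:ℝ) ^ (-((n:ℝ) * (s * (lam - μ) - s * (d:ℝ) * Real.logb 2 (1 + (n:ℝ)) / n -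
        Real.logb 2 (((ρ * mpow σ (-s)).trace).re)))) := by
  have hR := eq_spec hρ.1.1
  have hS := eq_spec hσ.1.1
  set U := hρ.1.1.eigenvectorUnitary
  set V := hσ.1.1.eigenvectorUnitary
  have hM : (0 : ℝ) < 2 ^ (μ * (n : ℝ)) := by positivity
  have ha : (0 : ℝ) < 2 ^ (lam * (n : ℝ)) := by positivity
  have hRn : tpow ρ n = spec (unitaryTpow U n) (fun x => ∏ i, hρ.1.1.eigenvalues (x i)) := by
    rw [← tpow_spec, ← hR]
  have hSn : tpow σ n = spec (unitaryTpow V n) (fun x => ∏ i, hσ.1.1.eigenvalues (x i)) := by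
    rw [← tpow_spec, ← hS]
  have key := trPos_spec_sub_smul_spec_le (unitaryTpow U n) (unitaryTpow V n)
    (r := fun x => ∏ i, hρ.1.1.eigenvalues (x i)) (t := fun x => ∏ i, hσ.1.1.eigenvalues (x i))
    (fun x => Finset.prod_nonneg fun i _ => hρ.1.eigenvalues_nonneg _)
    (fun x => Finset.prod_nonneg fun i _ => hσ.1.eigenvalues_nonneg _)
    (fun x hx => by
      obtain ⟨i, -, hi⟩ := Finset.prod_eq_zero_iff.1 hx
      rw [← hRn, unitaryTpow, ← tpow_star, ← tpow_mul, ← tpow_mul]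
      exact Finset.prod_eq_zero (Finset.mem_univ i) (eigen_diag_eq_zero hσ.1.1 hsupp hi))
    hM ha hs0 hs1
  rw [← tpow_mpow hρ.1, ← tpow_mpow hσ.1, ← hRn, ← hSn, ← tpow_mul, trace_tpow, trace_tpow,
    re_pow_of_nonneg (mpow_posSemidef hρ.1 _).trace_nonneg,
    re_pow_of_nonneg (trace_mul_nonneg hρ.1 (mpow_posSemidef hσ.1 _)),
    ← Real.rpow_sub two_pos, ← Real.rpow_mul two_pos.le, ← Real.rpow_mul two_pos.le] at key
  have hx : 0 ≤ (mpow ρ (1 + s)).trace.re :=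
    (Complex.le_def.1 (mpow_posSemidef hρ.1 _).trace_nonneg).1
  have hy : 0 ≤ (ρ * mpow σ (-s)).trace.re := re_trace_mul_nonneg hρ.1 (mpow_posSemidef hσ.1 _)
  have hn0 : (n : ℝ) ≠ 0 := by positivity
  have hlog : 0 ≤ s * (d : ℝ) * Real.logb 2 (1 + (n : ℝ)) :=
    mul_nonneg (by positivity) (Real.logb_nonneg one_lt_two (by linarith [n.cast_nonneg (α := ℝ)]))
  refine key.trans (add_le_add ((two_rpow_mul_pow_le hx hn).trans_eq ?_)
    ((two_rpow_mul_pow_le hy hn).trans ?_))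
  · ring_nf
  · refine Real.rpow_le_rpow_of_exponent_le one_le_two ?_
    have hcancel := mul_div_cancel₀ (s * (d : ℝ) * Real.logb 2 (1 + (n : ℝ))) hn0
    linarith

end GQSL
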